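/- arXiv:1801.00655 — 3 statements merged into one kernel-verified Lean document; each statement's English description precedes it below -/
import Mathlib

section
/- Let R be a commutative ring, ν : R → R a derivation, M an R-module, ∇ : M → M a connection along ν, and B : M × M → R an R-bilinear alternating form (B(x,x) = 0 for all x) satisfying the compatibility ν(B(x,y)) = B(∇x, y) + B(x, ∇y) for all x, y ∈ M. Fix x ∈ M and an integer n ≥ 1. Then B(∇⁽ⁱ⁾x, ∇⁽ʲ⁾x) = 0 for all 0 ≤ i, j ≤ n−1 if and only if B(∇⁽ⁱ⁾x, ∇⁽ⁱ⁺¹⁾x) = 0 for all 0 ≤ i < n−1, where ∇⁽ⁱ⁾ denotes the i-fold iterate of ∇. -/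
/-- If consecutive iterates of `x` under a map compatible with the alternating pairing `B` are
orthogonal up to order `m`, then so are all ordered pairs of iterates up to order `m`. -/
theorem pairing_iterate_add_eq_zero {R M : Type*} [AddCommGroup R] {ν : R → R} (hν : ν 0 = 0)
    {D : M → M} {B : M → M → R} (hB_alt : ∀ x : M, B x x = 0)
    (hB_compat : ∀ x y : M, ν (B x y) = B (D x) y + B x (D y)) {x : M} {m : ℕ}
    (h : ∀ i : ℕ, i < m → B (D^[i] x) (D^[i + 1] x) = 0) (k i : ℕ) (hik : i + k ≤ m) :
    B (D^[i] x) (D^[i + k] x) = 0 := by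
  induction k using Nat.twoStepInduction generalizing i with
  | zero => exact hB_alt _
  | one => exact h i hik
  | more k ih₀ ih₁ =>
    have hc := hB_compat (D^[i] x) (D^[i + (k + 1)] x)
    rw [ih₁ i (by lia), hν, ← Function.iterate_succ_apply' D, ← Function.iterate_succ_apply' D,
      show i + (k + 1) = i + 1 + k by lia, ih₀ (i + 1) (by lia), zero_add] at hc
    rw [show i + (k + 2) = (i + 1 + k).succ by lia, ← hc]

/-- Proposition `p:eq` (algebraic core): for a connection `D` along a derivation `ν`
compatible with an alternating bilinear form `B`, isotropy of all pairs of iterated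
derivatives of `x` up to order `n-1` is equivalent to isotropy of consecutive pairs. -/
theorem oper_criterion_symplectic
    {R M : Type*} [CommRing R] [AddCommGroup M] [Module R M]
    (ν : R → R)
    (hν_add : ∀ a b : R, ν (a + b) = ν a + ν b)
    (hν_mul : ∀ a b : R, ν (a * b) = a * ν b + b * ν a)
    (D : M → M)
    (hD_add : ∀ x y : M, D (x + y) = D x + D y)
    (hD_smul : ∀ (a : R) (x : M), D (a • x) = ν a • x + a • D x)
    (B : M → M → R)
    (hB_add_left : ∀ x y z : M, B (x + y) z = B x z + B y z)
    (hB_add_right : ∀ x y z : M, B x (y + z) = B x y + B x z)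
    (hB_smul_left : ∀ (a : R) (x y : M), B (a • x) y = a * B x y)
    (hB_smul_right : ∀ (a : R) (x y : M), B x (a • y) = a * B x y)
    (hB_alt : ∀ x : M, B x x = 0)
    (hB_compat : ∀ x y : M, ν (B x y) = B (D x) y + B x (D y))
    (x : M) (n : ℕ) (hn : 1 ≤ n) :
    (∀ i j : ℕ, i ≤ n - 1 → j ≤ n - 1 → B (D^[i] x) (D^[j] x) = 0) ↔
      (∀ i : ℕ, i < n - 1 → B (D^[i] x) (D^[i + 1] x) = 0) := by
  have hν : ν 0 = 0 := by simpa using hν_add 0 0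
  have hB_symm : ∀ y z : M, B y z = 0 → B z y = 0 := fun y z hyz => by
    have hyz' := hB_alt (y + z)
    rwa [hB_add_left, hB_add_right, hB_add_right, hB_alt, hB_alt, hyz, zero_add, zero_add,
      add_zero] at hyz'
  refine ⟨fun h i hi => h i (i + 1) hi.le hi, fun h => ?_⟩
  have key := pairing_iterate_add_eq_zero hν hB_alt hB_compat h
  intro i j hi hj
  rcases le_total i j with hij | hji
  · obtain ⟨k, rfl⟩ := Nat.exists_eq_add_of_le hij
    exact key k i hj
  · obtain ⟨k, rfl⟩ := Nat.exists_eq_add_of_le hji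
    exact hB_symm _ _ (key k j hi)
end

section
/- Let R be a commutative ring in which 2 is invertible, ν : R → R a derivation, M an R-module, ∇ : M → M a connection along ν, and B : M × M → R an R-bilinear symmetric form (B(x,y) = B(y,x) for all x, y) satisfying the compatibility ν(B(x,y)) = B(∇x, y) + B(x, ∇y) for all x, y ∈ M. Fix x ∈ M and an integer n ≥ 2. Then B(∇⁽ⁱ⁾x, ∇⁽ʲ⁾x) = 0 for all 0 ≤ i, j ≤ n−2 if and only if B(∇⁽ⁱ⁾x, ∇⁽ⁱ⁾x) = 0 for all 0 ≤ i ≤ n−2, where ∇⁽ⁱ⁾ denotes the i-fold iterate of ∇. -/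
/-- If each of the first `m + 1` terms of a sequence of iterates is isotropic, then so is every
pair of them at distance `k`. -/
theorem isotropic_iterate_add {R M : Type*} [CommRing R] (h2 : IsUnit (2 : R))
    (ν : R → R) (hν_zero : ν 0 = 0) (D : M → M) (B : M → M → R)
    (hB_symm : ∀ x y : M, B x y = B y x)
    (hB_compat : ∀ x y : M, ν (B x y) = B (D x) y + B x (D y))
    (x : M) (m : ℕ) (h : ∀ i ≤ m, B (D^[i] x) (D^[i] x) = 0) (k : ℕ) :
    ∀ i, i + k ≤ m → B (D^[i] x) (D^[i + k] x) = 0 := by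
  induction k using Nat.twoStepInduction with
  | zero => exact h
  | one =>
    intro i hi
    have hc := hB_compat (D^[i] x) (D^[i] x)
    rw [h i (by omega), hν_zero, hB_symm (D _), ← two_mul,
      ← Function.iterate_succ_apply' D] at hc
    exact h2.mul_right_eq_zero.mp hc.symm
  | more k ih ih' =>
    intro i hi
    have hc := hB_compat (D^[i] x) (D^[i + (k + 1)] x)
    rw [ih' i (by omega), hν_zero, ← Function.iterate_succ_apply' D,
      ← Function.iterate_succ_apply' D] at hc
    have hgap := ih (i + 1) (by omega)
    rw [show i + 1 + k = i + (k + 1) by omega] at hgap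
    rw [hgap, zero_add] at hc
    exact hc.symm

/-- Proposition `p:eq2` (algebraic core): for a connection `D` along a derivation `ν`
compatible with a symmetric bilinear form `B` over a ring in which `2` is invertible,
isotropy of all pairs of iterated derivatives of `x` up to order `n-2` is equivalent to
each iterated derivative being isotropic. -/
theorem oper_criterion_orthogonal
    {R M : Type*} [CommRing R] [AddCommGroup M] [Module R M]
    (h2 : IsUnit (2 : R))
    (ν : R → R)
    (hν_add : ∀ a b : R, ν (a + b) = ν a + ν b)
    (hν_mul : ∀ a b : R, ν (a * b) = a * ν b + b * ν a)
    (D : M → M)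
    (hD_add : ∀ x y : M, D (x + y) = D x + D y)
    (hD_smul : ∀ (a : R) (x : M), D (a • x) = ν a • x + a • D x)
    (B : M → M → R)
    (hB_add_left : ∀ x y z : M, B (x + y) z = B x z + B y z)
    (hB_add_right : ∀ x y z : M, B x (y + z) = B x y + B x z)
    (hB_smul_left : ∀ (a : R) (x y : M), B (a • x) y = a * B x y)
    (hB_smul_right : ∀ (a : R) (x y : M), B x (a • y) = a * B x y)
    (hB_symm : ∀ x y : M, B x y = B y x)
    (hB_compat : ∀ x y : M, ν (B x y) = B (D x) y + B x (D y))
    (x : M) (n : ℕ) (hn : 2 ≤ n) :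
    (∀ i j : ℕ, i ≤ n - 2 → j ≤ n - 2 → B (D^[i] x) (D^[j] x) = 0) ↔
      (∀ i : ℕ, i ≤ n - 2 → B (D^[i] x) (D^[i] x) = 0) := by
  have hν_zero : ν 0 = 0 := by simpa using hν_add 0 0
  refine ⟨fun h i hi => h i i hi hi, fun h i j hi hj => ?_⟩
  have key := isotropic_iterate_add h2 ν hν_zero D B hB_symm hB_compat x (n - 2) h
  rcases le_total i j with hij | hij
  · obtain ⟨k, rfl⟩ := Nat.exists_eq_add_of_le hij
    exact key k i hj
  · obtain ⟨k, rfl⟩ := Nat.exists_eq_add_of_le hij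
    rw [hB_symm]
    exact key k j hi
end

section
/- Let M be a commutative monoid acting freely and w-transitively on a nonempty set A. Equip A with the preorder a ≤ b defined by: there exists m ∈ M with m • a = b. Then the geometric realization of the nerve of this preorder (regarded as a category) is a contractible topological space. -/
open CategoryTheory

namespace NerveRealization

open Simplicial Opposite

variable {A : Type} [Preorder A]

/-- The simplex of the nerve of a preorder given by a finite monotone sequence. -/
def simplex {n : ℕ} (a : Fin (n + 1) →o A) : (nerve A).obj (op ⦋n⦌) :=
  a.monotone.functor

lemma exists_simplex_eq {n : ℕ} (x : (nerve A).obj (op ⦋n⦌)) :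
    ∃ a : Fin (n + 1) →o A, x = simplex a :=
  ⟨⟨x.obj, fun _ _ h ↦ leOfHom (x.map (homOfLE h))⟩, CategoryTheory.Functor.ext (fun _ ↦ rfl)⟩

/-- The characteristic map of a simplex in the geometric realization of the nerve. -/
noncomputable def point {n : ℕ} (a : Fin (n + 1) →o A) :
    C(stdSimplex ℝ (Fin (n + 1)), SSet.toTop.obj (nerve A)) :=
  (SSet.toTop.map (SSet.yonedaEquiv.symm (simplex a))).hom.comp
    ⟨(SimplexCategory.toTopHomeo ⦋n⦌).symm, (SimplexCategory.toTopHomeo ⦋n⦌).symm.continuous⟩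

lemma point_comp {m n : ℕ} (a : Fin (n + 1) →o A) (θ : Fin (m + 1) →o Fin (n + 1))
    (t : stdSimplex ℝ (Fin (m + 1))) :
    point (a.comp θ) t = point a (stdSimplex.map θ t) := by
  have h := SimplexCategory.toTopHomeo_symm_naturality_apply.{0}
    (SimplexCategory.Hom.mk θ : ⦋m⦌ ⟶ ⦋n⦌) t
  have h2 : SSet.yonedaEquiv.symm (simplex (a.comp θ)) =
      SSet.stdSimplex.map (SimplexCategory.Hom.mk θ : ⦋m⦌ ⟶ ⦋n⦌) ≫
        SSet.yonedaEquiv.symm (simplex a) := by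
    rw [SSet.yonedaEquiv_symm_naturality_left]
    rfl
  change (SSet.toTop.map (SSet.yonedaEquiv.symm (simplex (a.comp θ)))) _ =
    (SSet.toTop.map (SSet.yonedaEquiv.symm (simplex a))) _
  rw [h2, Functor.map_comp]
  exact congrArg (SSet.toTop.map (SSet.yonedaEquiv.symm (simplex a))) h.symm

lemma homEquiv_simplex_apply {Z : TopCat.{0}} (f : SSet.toTop.obj (nerve A) ⟶ Z) {n : ℕ}
    (a : Fin (n + 1) →o A) (t : stdSimplex ℝ (Fin (n + 1))) :
    TopCat.toSSetObjEquiv Z (op ⦋n⦌)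
      (((sSetTopAdj.homEquiv _ _ f).app (op ⦋n⦌)) (simplex a)) t = f (point a t) := by
  rw [Adjunction.homEquiv_unit]
  have := sSetTopAdj_unit_app_app_down (nerve A) (op ⦋n⦌) (simplex a)
  have h2 := congrArg (fun g : SimplexCategory.toTop.{0}.obj ⦋n⦌ ⟶ _ ↦ f (g (ULift.up t))) this
  exact h2

lemma hom_ext {Z : Type} [TopologicalSpace Z] {f g : C(SSet.toTop.obj (nerve A), Z)}
    (h : ∀ (n : ℕ) (a : Fin (n + 1) →o A) (t), f (point a t) = g (point a t)) : f = g := by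
  have : TopCat.ofHom f = TopCat.ofHom g := by
    apply (sSetTopAdj.homEquiv _ _).injective
    ext ⟨n⟩ x
    induction n using SimplexCategory.rec with | _ n
    obtain ⟨a, rfl⟩ := exists_simplex_eq x
    apply (TopCat.toSSetObjEquiv (TopCat.of Z) (op ⦋n⦌)).injective
    ext t
    exact (homEquiv_simplex_apply (TopCat.ofHom f) a t).trans
      ((h n a t).trans (homEquiv_simplex_apply (TopCat.ofHom g) a t).symm)
  exact congrArg TopCat.Hom.hom this

lemma exists_lift {Z : Type} [TopologicalSpace Z]
    (h : ∀ {n : ℕ}, (Fin (n + 1) →o A) → C(stdSimplex ℝ (Fin (n + 1)), Z))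
    (hh : ∀ {m n : ℕ} (a : Fin (n + 1) →o A) (θ : Fin (m + 1) →o Fin (n + 1)) (t),
      h (a.comp θ) t = h a (stdSimplex.map θ t)) :
    ∃ g : C(SSet.toTop.obj (nerve A), Z), ∀ {n : ℕ} (a : Fin (n + 1) →o A) (t),
      g (point a t) = h a t := by
  let F : nerve A ⟶ TopCat.toSSet.obj (TopCat.of Z) :=
    { app := fun n ↦ ↾fun x ↦ (TopCat.toSSetObjEquiv (TopCat.of Z) n).symm
        (h ⟨x.obj, fun _ _ h ↦ leOfHom (x.map (homOfLE h))⟩)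
      naturality := by
        rintro ⟨n⟩ ⟨m⟩ ⟨θ⟩
        ext x
        apply (TopCat.toSSetObjEquiv (TopCat.of Z) (op m)).injective
        ext t
        exact hh ⟨x.obj, fun _ _ h ↦ leOfHom (x.map (homOfLE h))⟩ θ.toOrderHom t }
  refine ⟨((sSetTopAdj.homEquiv _ _).symm F).hom, fun {n} a t ↦ ?_⟩
  have := homEquiv_simplex_apply ((sSetTopAdj.homEquiv _ _).symm F) a t
  rw [Equiv.apply_symm_apply] at this
  exact this.symm.trans rfl


section StepFunctions

open MeasureTheory Set Filter Topology

/-- The parameter space of step functions. -/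
abbrev Param : Type := Ioo (0 : ℝ) 1

noncomputable instance : MeasureSpace Param := Measure.Subtype.measureSpace

lemma volume_param_preimage (s : Set ℝ) :
    volume ((↑) ⁻¹' s : Set Param) = volume (s ∩ Ioo 0 1) := by
  rw [Measure.Subtype.volume_def, comap_subtype_coe_apply measurableSet_Ioo,
    Subtype.image_preimage_coe, inter_comm]

instance : IsProbabilityMeasure (volume : Measure Param) :=
  ⟨by simpa using volume_param_preimage univ⟩

lemma ae_param_ne (c : ℝ) : ∀ᵐ x : Param, (x : ℝ) ≠ c := by
  rw [ae_iff]
  have := volume_param_preimage {c}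
  rw [measure_mono_null inter_subset_left (by simp)] at this
  simpa [preimage] using this

lemma volume_real_param_le {c : ℝ} (h0 : 0 ≤ c) (h1 : c ≤ 1) :
    (volume : Measure Param).real {x | (x : ℝ) ≤ c} = c := by
  have h := volume_param_preimage (Iio c)
  have h2 : Iio c ∩ Ioo 0 1 = Ioo 0 c := by
    ext x
    simp only [mem_inter_iff, mem_Iio, mem_Ioo]
    constructor
    · tauto
    · rintro ⟨h, h'⟩; exact ⟨h', h, h'.trans_le h1⟩
  have h3 : (volume : Measure Param).real {x | (x : ℝ) ≤ c} =
      (volume : Measure Param).real ((↑) ⁻¹' Iio c) := by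
    apply measureReal_congr
    filter_upwards [ae_param_ne c] with x hx
    exact propext ⟨fun h ↦ lt_of_le_of_ne h hx, fun h ↦ le_of_lt h⟩
  rw [h3, measureReal_def, h, h2]
  simp [h0]

/-- The measure of the fiber of a function on the parameter space. -/
noncomputable def weight {P : Type} (φ : Param → P) (p : P) : ℝ :=
  (volume : Measure Param).real (φ ⁻¹' {p})

lemma weight_nonneg {P : Type} (φ : Param → P) (p : P) : 0 ≤ weight φ p :=
  measureReal_nonneg

lemma weight_congr {P : Type} {φ φ' : Param → P} (h : ∀ᵐ x, φ x = φ' x) (p : P) :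
    weight φ p = weight φ' p := by
  apply measureReal_congr
  filter_upwards [h] with x hx
  exact propext (by change φ x = p ↔ φ' x = p; rw [hx])

section

variable {P Q : Type} [PartialOrder P] [PartialOrder Q]

lemma measurableSet_fiber (ψ : Param →o P) (p : P) : MeasurableSet (ψ ⁻¹' {p}) :=
  (ordConnected_singleton.preimage_mono ψ.monotone).measurableSet

lemma weight_comp [Fintype P] {B : Type} [DecidableEq B] (ψ : Param →o P) (g : P → B) (b : B) :
    weight (g ∘ ψ) b = ∑ p with g p = b, weight ψ p := by
  have : (g ∘ ψ) ⁻¹' {b} = ⋃ p ∈ ({p | g p = b} : Finset P), ψ ⁻¹' {p} := by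
    ext x; simp
  rw [weight, this, measureReal_biUnion_finset]
  · rfl
  · intro p _ q _ hpq
    exact Disjoint.preimage _ (by simpa using hpq)
  · exact fun p _ ↦ measurableSet_fiber ψ p

lemma exists_enum {C : Finset P} (hne : C.Nonempty) (hC : IsChain (· ≤ ·) (C : Set P)) :
    ∃ (k : ℕ) (e : Fin (k + 1) ↪o P), range e = C := by
  classical
  let i : LinearOrder C :=
    { (inferInstance : PartialOrder C) with
      le_total := fun x y ↦ hC.total x.2 y.2
      toDecidableLE := Classical.decRel _ }
  obtain ⟨k, hk⟩ := Nat.exists_eq_succ_of_ne_zero hne.card_ne_zero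
  let e := Fintype.orderIsoFinOfCardEq C (k := k + 1) (by simpa using hk)
  refine ⟨k, e.toOrderEmbedding.trans (OrderEmbedding.subtype _), ?_⟩
  ext x
  constructor
  · rintro ⟨j, rfl⟩
    exact (e j).2
  · intro hx
    exact ⟨e.symm ⟨x, hx⟩, by simp⟩

lemma exists_factor {k : ℕ} (e : Fin (k + 1) ↪o P) (ψ : Param →o P) :
    ∃ ψ' : Param →o Fin (k + 1), ∀ x, ψ x ∈ range e → e (ψ' x) = ψ x := by
  classical
  refine ⟨⟨fun x ↦ (Finset.univ.filter (fun i ↦ e i ≤ ψ x)).sup id, fun x y hxy ↦ ?_⟩, ?_⟩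
  · refine Finset.sup_mono fun i hi ↦ ?_
    simp only [Finset.mem_filter, Finset.mem_univ, true_and] at hi ⊢
    exact hi.trans (ψ.monotone hxy)
  · rintro x ⟨j, hj⟩
    have : (Finset.univ.filter (fun i ↦ e i ≤ ψ x)).sup id = j :=
      le_antisymm (Finset.sup_le fun i hi ↦ by simpa [← hj] using hi)
        (Finset.le_sup (f := id) (by simp [← hj]))
    exact (congrArg e this).trans hj

lemma exists_of_weight_ne_zero {B : Type} {φ : Param → B} {b : B} (h : weight φ b ≠ 0)
    {R : Param → Prop} (hR : ∀ᵐ x, R x) : ∃ x, φ x = b ∧ R x := by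
  by_contra! hc
  apply h
  rw [weight, measureReal_eq_zero_iff, measure_eq_zero_iff_ae_notMem]
  filter_upwards [hR] with x hx hxb using hc x hxb hx

lemma isChain_support (ψ : Param →o P) : IsChain (· ≤ ·) {p | weight ψ p ≠ 0} := by
  intro p hp q hq _
  obtain ⟨x, rfl, -⟩ := exists_of_weight_ne_zero hp (ae_of_all _ fun _ ↦ trivial)
  obtain ⟨y, rfl, -⟩ := exists_of_weight_ne_zero hq (ae_of_all _ fun _ ↦ trivial)
  exact (le_total x y).imp (fun h ↦ ψ.monotone h) (fun h ↦ ψ.monotone h)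

lemma continuous_weight {Y : Type} [TopologicalSpace Y] [FirstCountableTopology Y]
    (ψ : Y → Param →o P) (h : ∀ y, ∀ᵐ x, ∀ᶠ y' in 𝓝 y, ψ y' x = ψ y x) (p : P) :
    Continuous fun y ↦ weight (ψ y) p := by
  refine continuous_iff_continuousAt.2 fun y ↦ ?_
  have := tendsto_measure_of_ae_tendsto_indicator_of_isFiniteMeasure (μ := volume) (𝓝 y)
    (measurableSet_fiber (ψ y) p) (fun y' ↦ measurableSet_fiber (ψ y') p) (by
      filter_upwards [h y] with x hx
      filter_upwards [hx] with y' hy'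
      simp [hy'])
  exact (ENNReal.tendsto_toReal (measure_ne_top _ _)).comp this

variable [Fintype P] [Fintype Q]

/-- The distribution of a monotone function on the parameter space with values in a finite
partial order. -/
noncomputable def dist (ψ : Param →o P) : stdSimplex ℝ P :=
  ⟨weight ψ, weight_nonneg ψ, by
    classical
    have := weight_comp ψ (fun _ ↦ ()) ()
    simp only [Finset.filter_true] at this
    rw [← this, weight]
    have : ((fun _ ↦ ()) ∘ ψ) ⁻¹' {()} = univ := by ext; simp
    rw [this]
    simp⟩

lemma map_dist (g : P →o Q) (ψ : Param →o P) :
    stdSimplex.map g (dist ψ) = dist (g.comp ψ) := by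
  classical
  ext q
  rw [stdSimplex.map_coe, FunOnFinite.linearMap_apply_apply]
  exact (weight_comp ψ g q).symm

lemma ae_weight_ne_zero (ψ : Param →o P) : ∀ᵐ x, weight ψ (ψ x) ≠ 0 := by
  have : ∀ p : P, ∀ᵐ x, weight ψ p = 0 → ψ x ≠ p := by
    intro p
    by_cases hp : weight ψ p = 0
    · have := (measureReal_eq_zero_iff).1 hp
      filter_upwards [measure_eq_zero_iff_ae_notMem.1 this] with x hx _ using hx
    · simp [hp]
  filter_upwards [ae_all_iff.2 this] with x hx h using hx _ h rfl

/-- A monotone function to a finite partial order factors almost everywhere through an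
enumeration of its essential values. -/
lemma exists_support_factor (ψ : Param →o P) :
    ∃ (k : ℕ) (e : Fin (k + 1) ↪o P) (ψ' : Param →o Fin (k + 1)),
      range e = {p | weight ψ p ≠ 0} ∧ ∀ᵐ x, ψ x = e (ψ' x) := by
  classical
  obtain ⟨x, hx⟩ := (ae_weight_ne_zero ψ).exists
  obtain ⟨k, e, he⟩ := exists_enum (C := {p | weight ψ p ≠ 0}) ⟨ψ x, by simpa using hx⟩
    (by simpa using isChain_support ψ)
  obtain ⟨ψ', h⟩ := exists_factor e ψ
  simp only [Finset.coe_filter, Finset.mem_univ, true_and] at he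
  refine ⟨k, e, ψ', he, ?_⟩
  filter_upwards [ae_weight_ne_zero ψ] with x hx
  exact (h x (by rw [he]; exact hx)).symm

lemma dist_congr {ψ ψ' : Param →o P} (h : ∀ᵐ x, ψ x = ψ' x) : dist ψ = dist ψ' := by
  ext p
  exact weight_congr h p

lemma point_dist_congr {m n : ℕ} {c : Fin (m + 1) →o A} {c' : Fin (n + 1) →o A}
    {ψ : Param →o Fin (m + 1)} {ψ' : Param →o Fin (n + 1)}
    (h : ∀ᵐ x, c (ψ x) = c' (ψ' x)) : point c (dist ψ) = point c' (dist ψ') := by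
  obtain ⟨k, e, Θ, he, hΘ⟩ := exists_support_factor (ψ.prod ψ')
  have h1 : dist ψ = dist ((OrderHom.fst.comp e.toOrderHom).comp Θ) :=
    dist_congr (by filter_upwards [hΘ] with x hx using congrArg Prod.fst hx)
  have h2 : dist ψ' = dist ((OrderHom.snd.comp e.toOrderHom).comp Θ) :=
    dist_congr (by filter_upwards [hΘ] with x hx using congrArg Prod.snd hx)
  rw [h1, h2, ← map_dist, ← map_dist, ← point_comp, ← point_comp]
  congr 2
  ext i
  have hi : e i ∈ {p | weight (ψ.prod ψ') p ≠ 0} := he ▸ mem_range_self i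
  obtain ⟨x, hx, hx'⟩ := exists_of_weight_ne_zero hi h
  change c (e i).1 = c' (e i).2
  rw [← hx]
  exact hx'

lemma exists_factorization (F : P →o A) (ψ : Param →o P) :
    ∃ (k : ℕ) (c : Fin (k + 1) →o A) (ψ' : Param →o Fin (k + 1)),
      ∀ᵐ x, F (ψ x) = c (ψ' x) := by
  obtain ⟨k, e, ψ', -, h⟩ := exists_support_factor ψ
  exact ⟨k, F.comp e.toOrderHom, ψ', by filter_upwards [h] with x hx using congrArg F hx⟩

/-- The point of the geometric realization of the nerve given by a monotone step function. -/
noncomputable def stepPoint (F : P →o A) (ψ : Param →o P) : SSet.toTop.obj (nerve A) :=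
  point (exists_factorization F ψ).choose_spec.choose
    (dist (exists_factorization F ψ).choose_spec.choose_spec.choose)

lemma stepPoint_eq_point {F : P →o A} {ψ : Param →o P} {k : ℕ} {c : Fin (k + 1) →o A}
    {ψ' : Param →o Fin (k + 1)} (h : ∀ᵐ x, F (ψ x) = c (ψ' x)) :
    stepPoint F ψ = point c (dist ψ') := by
  apply point_dist_congr
  filter_upwards [h, (exists_factorization F ψ).choose_spec.choose_spec.choose_spec]
    with x hx hx' using hx'.symm.trans hx

lemma stepPoint_congr {F : P →o A} {ψ : Param →o P} {F' : Q →o A} {ψ' : Param →o Q}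
    (h : ∀ᵐ x, F (ψ x) = F' (ψ' x)) : stepPoint F ψ = stepPoint F' ψ' := by
  apply stepPoint_eq_point
  filter_upwards [h, (exists_factorization F' ψ').choose_spec.choose_spec.choose_spec]
    with x hx hx' using hx.trans hx'

lemma continuous_stepPoint {Y : Type} [TopologicalSpace Y] [FirstCountableTopology Y]
    (F : P →o A) (ψ : Y → Param →o P) (h : ∀ y, ∀ᵐ x, ∀ᶠ y' in 𝓝 y, ψ y' x = ψ y x) :
    Continuous fun y ↦ stepPoint F (ψ y) := by
  classical
  have hw := continuous_weight ψ h
  let S (C : {C : Finset P // C.Nonempty ∧ IsChain (· ≤ ·) (C : Set P)}) : Set Y :=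
    {y | ∀ p ∉ C.1, weight (ψ y) p = 0}
  refine (locallyFinite_of_finite S).continuous ?_ ?_ ?_
  · refine eq_univ_of_forall fun y ↦ mem_iUnion.2 ?_
    obtain ⟨x, hx⟩ := (ae_weight_ne_zero (ψ y)).exists
    refine ⟨⟨({p | weight (ψ y) p ≠ 0} : Finset P), ⟨ψ y x, by simpa using hx⟩,
      by simpa using isChain_support (ψ y)⟩, fun p hp ↦ ?_⟩
    simpa using hp
  · intro C
    simp only [S, ofPred_forall]
    exact isClosed_iInter fun p ↦ isClosed_iInter fun _ ↦ isClosed_eq (hw p) continuous_const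
  · rintro ⟨C, hne, hC⟩
    obtain ⟨k, e, he⟩ := exists_enum hne hC
    choose ψ' hψ' using fun y ↦ exists_factor e (ψ y)
    have hae : ∀ y ∈ S ⟨C, hne, hC⟩, ∀ᵐ x, ψ y x = e (ψ' y x) := by
      intro y hy
      filter_upwards [ae_weight_ne_zero (ψ y)] with x hx
      refine (hψ' y x ?_).symm
      rw [he]
      by_contra hc
      exact hx (hy _ hc)
    rw [continuousOn_iff_continuous_domRestrict]
    have hcont : Continuous fun y : S ⟨C, hne, hC⟩ ↦ dist (ψ' y) := by
      refine Continuous.subtype_mk (continuous_pi fun i ↦ ?_) _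
      refine ((hw (e i)).comp continuous_subtype_val).congr fun y ↦ ?_
      refine (weight_congr (hae y.1 y.2) (e i)).trans ?_
      have : (fun x ↦ e (ψ' y x)) ⁻¹' {e i} = ψ' y ⁻¹' {i} := by ext; simp
      rw [weight, this]
      rfl
    refine ((point (F.comp e.toOrderHom)).continuous.comp hcont).congr fun y ↦ ?_
    refine (stepPoint_eq_point ?_).symm
    filter_upwards [hae y.1 y.2] with x hx using congrArg F hx

end


section StandardSteps

variable {n : ℕ}

lemma nonempty_le_sum_Iic (t : stdSimplex ℝ (Fin (n + 1))) (x : Param) :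
    ({i | (x : ℝ) ≤ ∑ j ∈ Finset.Iic i, t j} : Finset (Fin (n + 1))).Nonempty := by
  refine ⟨Fin.last n, ?_⟩
  have : Finset.Iic (Fin.last n) = Finset.univ := by ext; simp [Fin.le_last]
  simpa [this] using x.2.2.le

/-- The step function on the parameter space whose successive steps have the lengths prescribed
by a point of the standard simplex. -/
noncomputable def stdStep (t : stdSimplex ℝ (Fin (n + 1))) : Param →o Fin (n + 1) where
  toFun x := ({i | (x : ℝ) ≤ ∑ j ∈ Finset.Iic i, t j} : Finset (Fin (n + 1))).min'
    (nonempty_le_sum_Iic t x)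
  monotone' x y hxy := by
    refine Finset.min'_subset _ fun i hi ↦ ?_
    simp only [Finset.mem_filter, Finset.mem_univ, true_and] at hi ⊢
    exact (Subtype.coe_le_coe.2 hxy).trans hi

lemma stdStep_le_iff (t : stdSimplex ℝ (Fin (n + 1))) (x : Param) (i : Fin (n + 1)) :
    stdStep t x ≤ i ↔ (x : ℝ) ≤ ∑ j ∈ Finset.Iic i, t j := by
  refine ⟨fun h ↦ ?_, fun h ↦ Finset.min'_le _ _ (by simpa using h)⟩
  have h1 : (x : ℝ) ≤ ∑ j ∈ Finset.Iic (stdStep t x), t j :=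
    (Finset.mem_filter.1 (Finset.min'_mem _ (nonempty_le_sum_Iic t x))).2
  exact h1.trans (Finset.sum_le_sum_of_subset_of_nonneg (Finset.Iic_subset_Iic.2 h)
    fun j _ _ ↦ t.2.1 j)

lemma sum_Iic_injective {f g : Fin (n + 1) → ℝ}
    (h : ∀ i, ∑ j ∈ Finset.Iic i, f j = ∑ j ∈ Finset.Iic i, g j) : f = g := by
  ext i
  induction i using WellFoundedLT.induction with
  | ind i ih =>
    have := h i
    rw [← Finset.Iio_insert, Finset.sum_insert (by simp), Finset.sum_insert (by simp),
      Finset.sum_congr rfl fun j hj ↦ ih j (Finset.mem_Iio.1 hj)] at this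
    exact add_right_cancel this

lemma weight_stdStep (t : stdSimplex ℝ (Fin (n + 1))) (i : Fin (n + 1)) :
    weight (stdStep t) i = t i := by
  refine congrFun (sum_Iic_injective (f := weight (stdStep t)) (g := t) fun i ↦ ?_) i
  have h1 := weight_comp (stdStep t) (fun j ↦ decide (j ≤ i)) true
  have h2 : ({j | decide (j ≤ i) = true} : Finset (Fin (n + 1))) = Finset.Iic i := by ext; simp
  have h3 : ((fun j ↦ decide (j ≤ i)) ∘ stdStep t) ⁻¹' {true} =
      {x | ((x : Param) : ℝ) ≤ ∑ j ∈ Finset.Iic i, t j} := by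
    ext x; simp [stdStep_le_iff]
  rw [h2] at h1
  rw [← h1, weight, h3, volume_real_param_le]
  · exact Finset.sum_nonneg fun j _ ↦ t.2.1 j
  · rw [← stdSimplex.sum_eq_one t]
    exact Finset.sum_le_sum_of_subset_of_nonneg (Finset.subset_univ _) fun j _ _ ↦ t.2.1 j

lemma dist_stdStep (t : stdSimplex ℝ (Fin (n + 1))) : dist (stdStep t) = t := by
  ext i
  exact weight_stdStep t i

lemma stdStep_map {m : ℕ} (θ : Fin (m + 1) →o Fin (n + 1)) (t : stdSimplex ℝ (Fin (m + 1)))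
    (x : Param) : stdStep (stdSimplex.map θ t) x = θ (stdStep t x) := by
  have key (k : Fin (n + 1)) : ∑ j ∈ Finset.Iic k, stdSimplex.map θ t j =
      ∑ j with θ j ≤ k, t j := by
    simp only [stdSimplex.map_coe, FunOnFinite.linearMap_apply_apply]
    rw [← Finset.sum_fiberwise_of_maps_to (t := Finset.Iic k) (g := θ) (by simp)]
    refine Finset.sum_congr rfl fun j hj ↦ Finset.sum_congr ?_ fun _ _ ↦ rfl
    ext i
    simp only [Finset.mem_filter, Finset.mem_univ, true_and]
    exact ⟨fun h ↦ ⟨h ▸ Finset.mem_Iic.1 hj, h⟩, fun h ↦ h.2⟩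
  refine eq_of_forall_ge_iff fun k ↦ ?_
  rw [stdStep_le_iff, key]
  constructor
  · intro h
    by_contra! hk
    by_cases h0 : stdStep t x = 0
    · have : ({j | θ j ≤ k} : Finset (Fin (m + 1))) = ∅ := by
        ext j
        simpa using hk.trans_le (θ.monotone (h0 ▸ Fin.zero_le j))
      rw [this, Finset.sum_empty] at h
      exact absurd x.2.1 h.not_gt
    · have hx : ¬ stdStep t x ≤ Order.pred (stdStep t x) := by
        rw [not_le]
        exact Order.pred_lt_of_not_isMin fun h ↦ h0 h.eq_bot
      rw [stdStep_le_iff] at hx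
      refine hx (h.trans (Finset.sum_le_sum_of_subset_of_nonneg (fun j hj ↦ ?_)
        fun j _ _ ↦ t.2.1 j))
      rw [Finset.mem_Iic]
      refine Order.le_pred_of_lt (lt_of_not_ge fun hj' ↦ ?_)
      exact ((θ.monotone hj').trans (Finset.mem_filter.1 hj).2).not_gt hk
  · intro h
    refine ((stdStep_le_iff t x _).1 le_rfl).trans
      (Finset.sum_le_sum_of_subset_of_nonneg (fun j hj ↦ ?_) fun j _ _ ↦ t.2.1 j)
    simpa using (θ.monotone (Finset.mem_Iic.1 hj)).trans h

lemma continuous_coord (i : Fin (n + 1)) :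
    Continuous fun t : stdSimplex ℝ (Fin (n + 1)) ↦ t i :=
  (continuous_apply i).comp continuous_subtype_val

lemma eventually_lt_iff {Y : Type} [TopologicalSpace Y] {f g : Y → ℝ} {y : Y}
    (hf : ContinuousAt f y) (hg : ContinuousAt g y) (h : f y ≠ g y) :
    ∀ᶠ y' in 𝓝 y, (f y' < g y' ↔ f y < g y) := by
  rcases h.lt_or_gt with h | h
  · filter_upwards [hf.eventually_lt hg h] with y' hy'
    exact iff_of_true hy' h
  · filter_upwards [hg.eventually_lt hf h] with y' hy'
    exact iff_of_false hy'.not_gt h.not_gt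

lemma stdStep_eventually_eq (t : stdSimplex ℝ (Fin (n + 1))) :
    ∀ᵐ x, ∀ᶠ t' in 𝓝 t, stdStep t' x = stdStep t x := by
  filter_upwards [ae_all_iff.2 fun i ↦ ae_param_ne (∑ j ∈ Finset.Iic i, t j)] with x hx
  have : ∀ᶠ t' in 𝓝 t, ∀ i : Fin (n + 1), ((∑ j ∈ Finset.Iic i, t' j < (x : ℝ)) ↔
      ∑ j ∈ Finset.Iic i, t j < (x : ℝ)) :=
    eventually_all.2 fun i ↦ eventually_lt_iff
      (continuous_finsetSum _ fun j _ ↦ continuous_coord j).continuousAt continuousAt_const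
      (hx i).symm
  filter_upwards [this] with t' ht'
  refine eq_of_forall_ge_iff fun k ↦ ?_
  rw [stdStep_le_iff, stdStep_le_iff, ← not_lt, ht', not_lt]

end StandardSteps

section HeavyValues

variable {n : ℕ}

/-- The values of a function taken with weight larger than a proportion of the weight of any
other value. -/
def heavy {B : Type} (φ : Param → B) (x : Param) : Set B :=
  {b | ∀ b', (1 - (x : ℝ)) * weight φ b' < weight φ b}

lemma heavy_pos {B : Type} {φ : Param → B} {x : Param} {b : B} (h : b ∈ heavy φ x) :
    0 < weight φ b := by
  have h1 := h b
  have h2 := x.2.1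
  nlinarith [weight_nonneg φ b]

open Classical in
/-- The indices of the heavy values of the step function associated to a point of a simplex. -/
noncomputable def heavyIndices {B : Type} (a : Fin (n + 1) → B) (t : stdSimplex ℝ (Fin (n + 1)))
    (x : Param) : Finset (Fin (n + 1)) :=
  {i | a i ∈ heavy (a ∘ stdStep t) x}

lemma mem_heavyIndices {B : Type} {a : Fin (n + 1) → B} {t : stdSimplex ℝ (Fin (n + 1))}
    {x : Param} {i : Fin (n + 1)} :
    i ∈ heavyIndices a t x ↔ a i ∈ heavy (a ∘ stdStep t) x := by
  simp [heavyIndices]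

lemma image_heavyIndices {B : Type} (a : Fin (n + 1) → B) (t : stdSimplex ℝ (Fin (n + 1)))
    (x : Param) : a '' (heavyIndices a t x) = heavy (a ∘ stdStep t) x := by
  ext b
  constructor
  · rintro ⟨i, hi, rfl⟩
    exact mem_heavyIndices.1 hi
  · intro hb
    obtain ⟨y, rfl, -⟩ := exists_of_weight_ne_zero (heavy_pos hb).ne'
      (ae_of_all _ fun _ ↦ trivial)
    exact ⟨stdStep t y, mem_heavyIndices.2 hb, rfl⟩

lemma mem_heavy_iff {B : Type} {a : Fin (n + 1) → B} {t : stdSimplex ℝ (Fin (n + 1))}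
    {x : Param} {i : Fin (n + 1)} {k : Fin (n + 1)}
    (hk : ∀ j, weight (a ∘ stdStep t) (a j) ≤ weight (a ∘ stdStep t) (a k)) :
    a i ∈ heavy (a ∘ stdStep t) x ↔
      (1 - (x : ℝ)) * weight (a ∘ stdStep t) (a k) < weight (a ∘ stdStep t) (a i) := by
  have hx : 0 ≤ 1 - (x : ℝ) := by linarith [x.2.2]
  refine ⟨fun h ↦ h _, fun h b ↦ ?_⟩
  by_cases hb : weight (a ∘ stdStep t) b = 0
  · rw [hb, mul_zero]
    exact (mul_nonneg hx (weight_nonneg _ _)).trans_lt h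
  · obtain ⟨y, rfl, -⟩ := exists_of_weight_ne_zero hb (ae_of_all _ fun _ ↦ trivial)
    exact (mul_le_mul_of_nonneg_left (hk _) hx).trans_lt h

lemma exists_max_weight {B : Type} (a : Fin (n + 1) → B) (t : stdSimplex ℝ (Fin (n + 1))) :
    ∃ k, 0 < weight (a ∘ stdStep t) (a k) ∧
      ∀ j, weight (a ∘ stdStep t) (a j) ≤ weight (a ∘ stdStep t) (a k) := by
  classical
  obtain ⟨k, hk⟩ := Finite.exists_max fun j ↦ weight (a ∘ stdStep t) (a j)
  refine ⟨k, ?_, hk⟩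
  obtain ⟨i, hi⟩ : ∃ i, 0 < t i := by
    by_contra! hc
    have := stdSimplex.sum_eq_one t
    linarith [Finset.sum_nonpos fun i (_ : i ∈ Finset.univ) ↦ hc i]
  refine lt_of_lt_of_le ?_ (hk i)
  rw [weight_comp, ← weight_stdStep t i] at *
  exact hi.trans_le (Finset.single_le_sum (f := weight (stdStep t))
    (fun j _ ↦ weight_nonneg _ j) (by simp))

lemma heavyIndices_nonempty {B : Type} (a : Fin (n + 1) → B) (t : stdSimplex ℝ (Fin (n + 1)))
    (x : Param) : (heavyIndices a t x).Nonempty := by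
  obtain ⟨k, h0, hk⟩ := exists_max_weight a t
  refine ⟨k, mem_heavyIndices.2 ((mem_heavy_iff hk).2 ?_)⟩
  nlinarith [x.2.1]

lemma heavyIndices_mono {B : Type} (a : Fin (n + 1) → B) (t : stdSimplex ℝ (Fin (n + 1))) :
    Monotone (heavyIndices a t) := by
  intro x y hxy i hi
  rw [mem_heavyIndices] at hi ⊢
  refine fun b ↦ lt_of_le_of_lt (mul_le_mul_of_nonneg_right ?_ (weight_nonneg _ _)) (hi b)
  linarith [Subtype.coe_le_coe.2 hxy]

lemma continuous_weight_value {B : Type} (a : Fin (n + 1) → B) (b : B) :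
    Continuous fun t ↦ weight (a ∘ stdStep t) b := by
  classical
  simp only [weight_comp, weight_stdStep]
  exact continuous_finsetSum _ fun j _ ↦ continuous_coord j

lemma heavyIndices_eventually_eq {B : Type} (a : Fin (n + 1) → B)
    (t : stdSimplex ℝ (Fin (n + 1))) :
    ∀ᵐ x, ∀ᶠ t' in 𝓝 t, heavyIndices a t' x = heavyIndices a t x := by
  let w (s : stdSimplex ℝ (Fin (n + 1))) (i : Fin (n + 1)) := weight (a ∘ stdStep s) (a i)
  have hw (i : Fin (n + 1)) : Continuous fun s ↦ w s i := continuous_weight_value a (a i)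
  filter_upwards [ae_all_iff.2 fun p : Fin (n + 1) × Fin (n + 1) ↦
    ae_param_ne (1 - w t p.1 / w t p.2)] with x hx
  obtain ⟨k, h0, hk⟩ := exists_max_weight a t
  have hx1 : 0 < 1 - (x : ℝ) := by linarith [x.2.2]
  have hne (i j : Fin (n + 1)) (hij : 0 < w t i ∨ 0 < w t j) :
      (1 - (x : ℝ)) * w t j ≠ w t i := by
    intro h
    by_cases hj : w t j = 0
    · rw [hj, mul_zero] at h
      rcases hij with hij | hij
      · exact hij.ne h
      · exact hij.ne' hj
    · refine hx (i, j) ?_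
      rw [← h, mul_div_cancel_right₀ _ hj]
      ring
  have hev (i j : Fin (n + 1)) (hij : 0 < w t i ∨ 0 < w t j) :=
    eventually_lt_iff ((continuous_const.mul (hw j)).continuousAt) (hw i).continuousAt
      (hne i j hij)
  have hall : ∀ᶠ t' in 𝓝 t, ∀ i j, (0 < w t i ∨ 0 < w t j) →
      ((1 - (x : ℝ)) * w t' j < w t' i ↔ (1 - (x : ℝ)) * w t j < w t i) := by
    simp only [eventually_all]
    exact hev
  filter_upwards [hall] with t' ht'
  ext i
  rw [mem_heavyIndices, mem_heavyIndices, mem_heavy_iff hk]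
  constructor
  · intro h
    exact (ht' i k (Or.inr h0)).1 (h _)
  · intro h
    obtain ⟨k', -, hk'⟩ := exists_max_weight a t'
    rw [mem_heavy_iff hk']
    have hi : 0 < w t i := (mul_pos hx1 h0).trans h
    exact (ht' i k' (Or.inl hi)).2
      ((mul_le_mul_of_nonneg_left (hk k') hx1.le).trans_lt h)

end HeavyValues

section ChainOperators

variable {n : ℕ}

/-- An operation on pairs consisting of an element of a preorder and a nonempty finite chain
comparable with it, monotone in both arguments. -/
structure ChainOperator (A : Type) [Preorder A] where
  /-- The underlying function; only its values on finite nonempty chains matter. -/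
  toFun : A → Set A → A
  monotone' : ∀ {b b' : A} {T T' : Set A}, b ≤ b' → T ⊆ T' → T.Nonempty → T'.Finite →
    IsChain (· ≤ ·) (insert b (insert b' T')) → toFun b T ≤ toFun b' T'

/-- The pairs of an index and a nonempty set of indices. -/
abbrev IndexPair (n : ℕ) : Type := Fin (n + 1) × {S : Finset (Fin (n + 1)) // S.Nonempty}

lemma isChain_image (a : Fin (n + 1) →o A) (i j : Fin (n + 1)) (S : Finset (Fin (n + 1))) :
    IsChain (· ≤ ·) (insert (a i) (insert (a j) (a '' (S : Set (Fin (n + 1)))))) := by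
  rw [← image_insert_eq, ← image_insert_eq]
  rintro _ ⟨k, -, rfl⟩ _ ⟨l, -, rfl⟩ _
  exact (le_total k l).imp (fun h ↦ a.monotone h) fun h ↦ a.monotone h

/-- The monotone function on pairs of indices obtained by evaluating an operator on a monotone
sequence. -/
def ChainOperator.eval (G : ChainOperator A) (a : Fin (n + 1) →o A) : IndexPair n →o A where
  toFun p := G.toFun (a p.1) (a '' p.2.1)
  monotone' p q h := G.monotone' (a.monotone h.1) (image_mono (Finset.coe_subset.2 h.2))
    ((Finset.coe_nonempty.2 p.2.2).image a) (q.2.1.finite_toSet.image a) (isChain_image a _ _ _)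

/-- The standard step function together with the heavy indices. -/
noncomputable def heavyStep (a : Fin (n + 1) →o A) (t : stdSimplex ℝ (Fin (n + 1))) :
    Param →o IndexPair n where
  toFun x := (stdStep t x, ⟨heavyIndices a t x, heavyIndices_nonempty a t x⟩)
  monotone' _ _ h := ⟨(stdStep t).monotone h, heavyIndices_mono a t h⟩

lemma heavyStep_eventually_eq (a : Fin (n + 1) →o A) (t : stdSimplex ℝ (Fin (n + 1))) :
    ∀ᵐ x, ∀ᶠ t' in 𝓝 t, heavyStep a t' x = heavyStep a t x := by
  filter_upwards [stdStep_eventually_eq t, heavyIndices_eventually_eq a t] with x h1 h2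
  filter_upwards [h1, h2] with t' h1 h2
  exact Prod.ext h1 (Subtype.ext h2)

lemma eval_heavyStep (G : ChainOperator A) (a : Fin (n + 1) →o A)
    (t : stdSimplex ℝ (Fin (n + 1))) (x : Param) :
    G.eval a (heavyStep a t x) = G.toFun (a (stdStep t x)) (heavy (a ∘ stdStep t) x) := by
  rw [← image_heavyIndices]
  rfl

lemma eval_heavyStep_comp {m : ℕ} (G : ChainOperator A) (a : Fin (n + 1) →o A)
    (θ : Fin (m + 1) →o Fin (n + 1)) (t : stdSimplex ℝ (Fin (m + 1))) (x : Param) :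
    G.eval (a.comp θ) (heavyStep (a.comp θ) t x) =
      G.eval a (heavyStep a (stdSimplex.map θ t) x) := by
  have : a ∘ stdStep (stdSimplex.map θ t) = a.comp θ ∘ stdStep t :=
    funext fun y ↦ congrArg a (stdStep_map θ t y)
  rw [eval_heavyStep, eval_heavyStep, this, stdStep_map]
  rfl

/-- A self-map of the geometric realization of the nerve is given on simplices by a chain
operator. -/
def Realizes (G : ChainOperator A)
    (g : C(SSet.toTop.obj (nerve A), SSet.toTop.obj (nerve A))) : Prop :=
  ∀ (n : ℕ) (a : Fin (n + 1) →o A) (t), g (point a t) = stepPoint (G.eval a) (heavyStep a t)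

/-- The monotone function interpolating between two comparable ones. -/
def interpolate {P : Type} [Preorder P] (F₀ F₁ : P →o A) (h : F₀ ≤ F₁) : P × Bool →o A where
  toFun p := if p.2 then F₁ p.1 else F₀ p.1
  monotone' := by
    rintro ⟨p, _ | _⟩ ⟨q, _ | _⟩ ⟨hpq, hc⟩
    · exact F₀.monotone hpq
    · exact (h p).trans (F₁.monotone hpq)
    · exact absurd (hc rfl) Bool.false_ne_true
    · exact F₁.monotone hpq

/-- The step function that switches on at `1 - s`. -/
noncomputable def switch (s : unitInterval) : Param →o Bool where
  toFun x := decide (1 - (s : ℝ) ≤ x)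
  monotone' x y h := by
    simp only [Bool.le_iff_imp, decide_eq_true_eq]
    exact fun h' ↦ h'.trans h

lemma switch_eventually_eq (s : unitInterval) :
    ∀ᵐ x, ∀ᶠ s' in 𝓝 s, switch s' x = switch s x := by
  filter_upwards [ae_param_ne (1 - s)] with x hx
  filter_upwards [eventually_lt_iff (f := fun _ ↦ (x : ℝ))
    (g := fun s' : unitInterval ↦ 1 - (s' : ℝ)) continuousAt_const (by fun_prop) hx] with s' hs'
  exact decide_eq_decide.2 (by rw [← not_lt, hs', not_lt])

lemma switch_zero (x : Param) : switch 0 x = false := by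
  simpa [switch] using x.2.2

lemma switch_one (x : Param) : switch 1 x = true := by
  simpa [switch] using x.2.1.le

/-- Comparable chain operators are realized by homotopic maps. -/
lemma exists_homotopic {G₀ G₁ : ChainOperator A}
    (h : ∀ b T, T.Nonempty → T.Finite → IsChain (· ≤ ·) (insert b T) →
      G₀.toFun b T ≤ G₁.toFun b T) :
    ∃ g₀ g₁, Realizes G₀ g₀ ∧ Realizes G₁ g₁ ∧ g₀.Homotopic g₁ := by
  have hle {n : ℕ} (a : Fin (n + 1) →o A) : G₀.eval a ≤ G₁.eval a := fun p ↦
    h _ _ ((Finset.coe_nonempty.2 p.2.2).image a) (p.2.1.finite_toSet.image a) 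
      (by simpa using isChain_image a p.1 p.1 p.2.1)
  let Φ {n : ℕ} (a : Fin (n + 1) →o A) :
      C(stdSimplex ℝ (Fin (n + 1)) × unitInterval, SSet.toTop.obj (nerve A)) :=
    { toFun := fun y ↦ stepPoint (interpolate _ _ (hle a)) ((heavyStep a y.1).prod (switch y.2))
      continuous_toFun := continuous_stepPoint _ _ fun y ↦ by
        filter_upwards [heavyStep_eventually_eq a y.1, switch_eventually_eq y.2] with x h1 h2
        rw [nhds_prod_eq]
        filter_upwards [h1.prod_mk h2] with y' hy'
        exact Prod.ext hy'.1 hy'.2 }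
  obtain ⟨g, hg⟩ := exists_lift (fun {n} a ↦ (Φ a).curry) (by
    intro m n a θ t
    ext s
    refine stepPoint_congr (ae_of_all _ fun x ↦ ?_)
    change (if switch s x = true then _ else _) = (if switch s x = true then _ else _)
    simp only [OrderHom.prod_coe, eval_heavyStep_comp])
  let H := g.uncurry
  refine ⟨H.comp ⟨fun y ↦ (y, 0), by fun_prop⟩, H.comp ⟨fun y ↦ (y, 1), by fun_prop⟩, ?_, ?_, ?_⟩
  · intro n a t
    refine (DFunLike.congr_fun (hg a t) 0).trans (stepPoint_congr (ae_of_all _ fun x ↦ ?_))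
    change (if switch 0 x = true then _ else _) = _
    simp [switch_zero]
  · intro n a t
    refine (DFunLike.congr_fun (hg a t) 1).trans (stepPoint_congr (ae_of_all _ fun x ↦ ?_))
    change (if switch 1 x = true then _ else _) = _
    simp [switch_one]
  · exact ⟨{ toFun := fun p ↦ H (p.2, p.1)
             continuous_toFun := by fun_prop
             map_zero_left := fun _ ↦ rfl
             map_one_left := fun _ ↦ rfl }⟩

lemma Realizes.unique {G : ChainOperator A} {g g'} (h : Realizes G g) (h' : Realizes G g') :
    g = g' :=
  hom_ext fun n a t ↦ (h n a t).trans (h' n a t).symm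

lemma Realizes.homotopic {G₀ G₁ : ChainOperator A} {g₀ g₁} (h₀ : Realizes G₀ g₀)
    (h₁ : Realizes G₁ g₁) (h : ∀ b T, T.Nonempty → T.Finite → IsChain (· ≤ ·) (insert b T) →
      G₀.toFun b T ≤ G₁.toFun b T) : g₀.Homotopic g₁ := by
  obtain ⟨g₀', g₁', h₀', h₁', hg⟩ := exists_homotopic h
  rwa [h₀.unique h₀', h₁.unique h₁']

lemma exists_realizes (G : ChainOperator A) : ∃ g, Realizes G g := by
  obtain ⟨g, -, hg, -⟩ := exists_homotopic (G₀ := G) (G₁ := G) fun _ _ _ _ _ ↦ le_rfl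
  exact ⟨g, hg⟩

/-- The projection to the element. -/
def projection (A : Type) [Preorder A] : ChainOperator A where
  toFun b _ := b
  monotone' h _ _ _ _ := h

lemma realizes_projection : Realizes (projection A) (.id _) := by
  intro n a t
  refine (Eq.trans ?_ (stepPoint_eq_point (c := a) (ψ' := stdStep t)
    (ae_of_all _ fun x ↦ ?_)).symm)
  · rw [dist_stdStep]
    rfl
  · rfl

/-- The constant operator. -/
def constOperator (a₀ : A) : ChainOperator A where
  toFun _ _ := a₀
  monotone' _ _ _ _ _ := le_rfl

lemma realizes_constant (a₀ : A) : ∃ p, Realizes (constOperator a₀) (.const _ p) := by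
  refine ⟨stepPoint (OrderHom.const _ a₀) (OrderHom.const _ ()), fun n a t ↦ ?_⟩
  exact stepPoint_congr (ae_of_all _ fun _ ↦ rfl)

lemma exists_greatest {T : Set A} (hT : T.Nonempty) (hfin : T.Finite) (hc : IsChain (· ≤ ·) T) :
    ∃ b ∈ T, ∀ c ∈ T, c ≤ b := by
  obtain ⟨b, hb, hmax⟩ := hfin.exists_maximal hT
  exact ⟨b, hb, fun c hc' ↦ (hc.total hc' hb).elim id fun h ↦ hmax hc' h⟩

variable [Nonempty A]

open Classical in
/-- A greatest element of a set, if there is one. -/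
noncomputable def greatest (T : Set A) : A :=
  if h : ∃ b ∈ T, ∀ c ∈ T, c ≤ b then h.choose else Classical.arbitrary A

lemma greatest_mem {T : Set A} (hT : T.Nonempty) (hfin : T.Finite) (hc : IsChain (· ≤ ·) T) :
    greatest T ∈ T := by
  rw [greatest, dif_pos (exists_greatest hT hfin hc)]
  exact (exists_greatest hT hfin hc).choose_spec.1

lemma le_greatest {T : Set A} (hT : T.Nonempty) (hfin : T.Finite) (hc : IsChain (· ≤ ·) T)
    {c : A} (h : c ∈ T) : c ≤ greatest T := by
  rw [greatest, dif_pos (exists_greatest hT hfin hc)]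
  exact (exists_greatest hT hfin hc).choose_spec.2 c h

/-- The greatest element of the chain. -/
noncomputable def greatestOfChain (A : Type) [Preorder A] [Nonempty A] : ChainOperator A where
  toFun _ T := greatest T
  monotone' {b b' T T'} _ h hT hfin hc := by
    have hc' := hc.mono ((subset_insert b' T').trans (subset_insert b _))
    exact le_greatest (hT.mono h) hfin hc' (h (greatest_mem hT (hfin.subset h) (hc'.mono h)))

/-- The greatest element of the chain and the additional element. -/
noncomputable def greatestOfInsert (A : Type) [Preorder A] [Nonempty A] : ChainOperator A where
  toFun b T := greatest (insert b T)
  monotone' {b b' T T'} hb h hT hfin hc := by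
    have hc' := hc.mono (subset_insert b _)
    have hle {c : A} (hc : c ∈ insert b' T') : c ≤ greatest (insert b' T') :=
      le_greatest (insert_nonempty _ _) (hfin.insert _) hc' hc
    have hmem := greatest_mem (insert_nonempty b T) ((hfin.subset h).insert b)
      (hc.mono (insert_subset_insert (h.trans (subset_insert _ _))))
    rcases hmem with hmem | hmem
    · rw [hmem]
      exact hb.trans (hle (mem_insert _ _))
    · exact hle (mem_insert_of_mem _ (h hmem))

variable [IsDirectedOrder A]

lemma exists_monotone_bound (a₀ : A) :
    ∃ f : Finset A → A, Monotone f ∧ (∀ s, a₀ ≤ f s) ∧ ∀ s, ∀ b ∈ s, b ≤ f s := by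
  classical
  let f : Finset A → A := Finset.strongInduction fun s ih ↦
    (Finset.exists_le (insert a₀ (s ∪ s.ssubsets.attach.image
      fun u ↦ ih u.1 (Finset.mem_ssubsets.1 u.2)))).choose
  have hf (s : Finset A) : ∀ b ∈ insert a₀ (s ∪ s.ssubsets.image f), b ≤ f s := by
    intro b hb
    have := (Finset.exists_le (insert a₀ (s ∪ s.ssubsets.attach.image fun u ↦ f u.1))).choose_spec
    have hfs : f s = (Finset.exists_le (insert a₀ (s ∪ s.ssubsets.attach.image
      fun u ↦ f u.1))).choose := Finset.strongInduction_eq _ s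
    rw [hfs]
    refine this b ?_
    simpa using hb
  refine ⟨f, fun s u hsu ↦ ?_, fun s ↦ hf s _ (by simp), fun s b hb ↦ hf s b (by simp [hb])⟩
  rcases eq_or_ssubset_of_subset hsu with rfl | h
  · exact le_rfl
  · refine hf u _ (Finset.mem_insert_of_mem (Finset.mem_union_right _ ?_))
    exact Finset.mem_image_of_mem f (Finset.mem_ssubsets.2 h)

open Classical in
/-- An upper bound of the chain, for a monotone choice of upper bounds of finite sets. -/
noncomputable def boundOfChain (f : Finset A → A) (hf : Monotone f) : ChainOperator A where
  toFun _ T := f (if h : T.Finite then h.toFinset else ∅)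
  monotone' _ h _ hfin _ := by
    rw [dif_pos hfin, dif_pos (hfin.subset h)]
    exact hf (Finite.toFinset_subset_toFinset.2 h)

/-- The geometric realization of the nerve of a nonempty directed preorder is contractible. -/
theorem contractibleSpace_toTop_nerve : ContractibleSpace (SSet.toTop.obj (nerve A)) := by
  obtain ⟨f, hf, hf₀, hle⟩ := exists_monotone_bound (Classical.arbitrary A)
  obtain ⟨p, hp⟩ := realizes_constant (Classical.arbitrary A)
  obtain ⟨g₁, h₁⟩ := exists_realizes (greatestOfInsert A)
  obtain ⟨g₂, h₂⟩ := exists_realizes (greatestOfChain A)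
  obtain ⟨g₃, h₃⟩ := exists_realizes (boundOfChain f hf)
  refine (contractible_iff_id_nullhomotopic _).2 ⟨p, ?_⟩
  refine (realizes_projection.homotopic h₁ fun b T _ hfin hc ↦ ?_).trans
    ((h₂.homotopic h₁ fun b T hT hfin hc ↦ ?_).symm.trans
    ((h₂.homotopic h₃ fun b T hT hfin hc ↦ ?_).trans
    (hp.homotopic h₃ fun b T _ hfin _ ↦ ?_).symm))
  · exact le_greatest (insert_nonempty _ _) (hfin.insert b) hc (mem_insert b T)
  · exact le_greatest (insert_nonempty _ _) (hfin.insert b) hc (mem_insert_of_mem _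
      (greatest_mem hT hfin (hc.mono (subset_insert _ _))))
  · refine hle _ _ ?_
    rw [dif_pos hfin, Finite.mem_toFinset]
    exact greatest_mem hT hfin (hc.mono (subset_insert _ _))
  · exact hf₀ _

end ChainOperators

end StepFunctions

end NerveRealization

/-- Bar-construction lemma, key case: if a commutative monoid `M` acts freely and
w-transitively on a nonempty set `A`, then the geometric realization of the nerve of the
preorder `a ≤ b ↔ ∃ m, m • a = b` on `A` is contractible. -/
theorem contractible_realization_nerve_of_free_wtransitive_action
    (M A : Type) [CommMonoid M] [MulAction M A] [Nonempty A]
    (hfree : ∀ (m n : M) (a : A), m • a = n • a → m = n)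
    (hw : ∀ a b : A, ∃ m n : M, m • a = n • b)
    (inst : Preorder A)
    (hle : ∀ a b : A, a ≤ b ↔ ∃ m : M, m • a = b) :
    ContractibleSpace (SSet.toTop.obj (nerve A)) := by
  have : IsDirectedOrder A := ⟨fun a b ↦ by
    obtain ⟨m, n, h⟩ := hw a b
    exact ⟨m • a, (hle _ _).2 ⟨m, rfl⟩, (hle _ _).2 ⟨n, h.symm⟩⟩⟩
  exact NerveRealization.contractibleSpace_toTop_nerve
end
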